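/- For real a > 0 and b > 0, ∫_0^∞ e^{-a²x²}/(x² + b²) dx = (π/(2b)) e^{a²b²} (1 − erf(ab)), where erf is the error function erf(z) = (2/√π)∫_0^z e^{-t²} dt. -/

import Mathlib

/-- The Gauss error function `erf z = (2/√π) ∫_0^z exp(-t²) dt`. -/
noncomputable def erf (z : ℝ) : ℝ :=
  2 / Real.sqrt Real.pi * ∫ t in (0 : ℝ)..z, Real.exp (-t ^ 2)

open MeasureTheory Set Filter Topology in
theorem aux_inv (b : ℝ) (hb : 0 < b) :
    IntegrableOn (fun x : ℝ => 1 / (x ^ 2 + b ^ 2)) (Ioi 0) ∧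
    ∫ x in Ioi (0 : ℝ), 1 / (x ^ 2 + b ^ 2) = Real.pi / (2 * b) := by
  have hd : ∀ x ∈ Ici (0 : ℝ),
      HasDerivAt (fun x : ℝ => Real.arctan (x / b) / b) (1 / (x ^ 2 + b ^ 2)) x := by
    intro x _
    have h := (((hasDerivAt_id x).div_const b).arctan).div_const b
    refine h.congr_deriv ?_
    have h1 : x ^ 2 + b ^ 2 ≠ 0 := by positivity
    have h2 : 1 + (x / b) ^ 2 ≠ 0 := by positivity
    simp only [id]
    field_simp
    ring
  have ht : Tendsto (fun x : ℝ => Real.arctan (x / b) / b) atTop (𝓝 (Real.pi / 2 / b)) := by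
    refine Tendsto.div_const ?_ b
    exact (tendsto_nhds_of_tendsto_nhdsWithin Real.tendsto_arctan_atTop).comp
      (tendsto_id.atTop_div_const hb)
  have hi : IntegrableOn (fun x : ℝ => 1 / (x ^ 2 + b ^ 2)) (Ioi 0) :=
    integrableOn_Ioi_deriv_of_nonneg' hd (fun x _ => by positivity) ht
  refine ⟨hi, ?_⟩
  rw [integral_Ioi_of_hasDerivAt_of_tendsto' hd hi ht]
  simp
  field_simp

open MeasureTheory Set Filter Topology in
theorem aux_cont (b : ℝ) (hb : 0 < b) :
    Continuous (fun s : ℝ => ∫ x in Ioi (0 : ℝ),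
      Real.exp (-(s ^ 2 * (x ^ 2 + b ^ 2))) / (x ^ 2 + b ^ 2)) := by
  have hne : ∀ x : ℝ, x ^ 2 + b ^ 2 ≠ 0 := fun x => by positivity
  refine continuous_of_dominated (bound := fun x => 1 / (x ^ 2 + b ^ 2)) ?_ ?_ (aux_inv b hb).1 ?_
  · intro s
    exact (by fun_prop (disch := exact hne _) : Continuous (fun x : ℝ =>
      Real.exp (-(s ^ 2 * (x ^ 2 + b ^ 2))) / (x ^ 2 + b ^ 2))).aestronglyMeasurable
  · intro s
    refine ae_of_all _ fun x => ?_
    rw [Real.norm_of_nonneg (by positivity)]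
    gcongr
    rw [Real.exp_le_one_iff]
    have : 0 ≤ s ^ 2 * (x ^ 2 + b ^ 2) := by positivity
    linarith
  · refine ae_of_all _ fun x => ?_
    fun_prop

open MeasureTheory Set Filter Topology in
theorem aux_deriv (b : ℝ) (hb : 0 < b) (s : ℝ) (hs : 0 < s) :
    HasDerivAt (fun s : ℝ => ∫ x in Ioi (0 : ℝ),
      Real.exp (-(s ^ 2 * (x ^ 2 + b ^ 2))) / (x ^ 2 + b ^ 2))
      (-(Real.sqrt Real.pi * Real.exp (-(s * b) ^ 2))) s := by
  have hne : ∀ x : ℝ, x ^ 2 + b ^ 2 ≠ 0 := fun x => by positivity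
  have hc : ∀ s : ℝ, Continuous (fun x : ℝ =>
      Real.exp (-(s ^ 2 * (x ^ 2 + b ^ 2))) / (x ^ 2 + b ^ 2)) := fun s => by
    fun_prop (disch := exact hne _)
  have key := hasDerivAt_integral_of_dominated_loc_of_deriv_le (μ := volume.restrict (Ioi (0 : ℝ)))
    (F := fun s x : ℝ => Real.exp (-(s ^ 2 * (x ^ 2 + b ^ 2))) / (x ^ 2 + b ^ 2))
    (F' := fun s x : ℝ => -(2 * s) * Real.exp (-(s ^ 2 * (x ^ 2 + b ^ 2))))
    (x₀ := s) (s := Ioo (s / 2) (2 * s))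
    (bound := fun x => 2 * (2 * s) * Real.exp (-(s / 2) ^ 2 * x ^ 2))
    (Ioo_mem_nhds (by linarith) (by linarith))
    (Eventually.of_forall fun s => (hc s).aestronglyMeasurable) ?_
    ((by fun_prop : Continuous _).aestronglyMeasurable) ?_ ?_ ?_
  · refine key.2.congr_deriv ?_
    have h1 : ∀ x : ℝ, -(2 * s) * Real.exp (-(s ^ 2 * (x ^ 2 + b ^ 2)))
        = (-(2 * s) * Real.exp (-(s * b) ^ 2)) * Real.exp (-s ^ 2 * x ^ 2) := by
      intro x
      rw [mul_assoc, ← Real.exp_add]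
      congr 2
      ring
    simp only [h1]
    rw [integral_const_mul, integral_gaussian_Ioi, Real.sqrt_div Real.pi_pos.le,
      Real.sqrt_sq hs.le]
    field_simp
  · refine (aux_inv b hb).1.mono' (hc s).aestronglyMeasurable (ae_of_all _ fun x => ?_)
    rw [Real.norm_of_nonneg (by positivity)]
    gcongr
    rw [Real.exp_le_one_iff]
    have : 0 ≤ s ^ 2 * (x ^ 2 + b ^ 2) := by positivity
    linarith
  · refine ae_of_all _ fun x t ht => ?_
    have ht0 : 0 < t := by linarith [ht.1]
    rw [norm_mul, norm_neg, Real.norm_of_nonneg (by positivity), Real.norm_of_nonneg (by positivity)]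
    have h2 : (s / 2) ^ 2 ≤ t ^ 2 := by
      have := ht.1.le
      gcongr
    have h3 : (s / 2) ^ 2 * x ^ 2 ≤ t ^ 2 * (x ^ 2 + b ^ 2) := by
      gcongr
      nlinarith [sq_nonneg b]
    have := ht.2.le
    gcongr
    linarith
  · exact ((integrable_exp_neg_mul_sq (by positivity)).const_mul _).integrableOn
  · refine ae_of_all _ fun x t _ => ?_
    have h := (((hasDerivAt_pow 2 t).mul_const (x ^ 2 + b ^ 2)).fun_neg.exp).div_const (x ^ 2 + b ^ 2)
    refine h.congr_deriv ?_
    have := hne x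
    field_simp
    simp [mul_comm]

theorem aux_erf (b s : ℝ) :
    HasDerivAt (fun s : ℝ => erf (s * b))
      (2 / Real.sqrt Real.pi * (Real.exp (-(s * b) ^ 2) * b)) s := by
  unfold erf
  have hc : Continuous (fun t : ℝ => Real.exp (-t ^ 2)) := by fun_prop
  have h1 := (hc.integral_hasStrictDerivAt 0 (s * b)).hasDerivAt
  have h2 : HasDerivAt (fun s : ℝ => s * b) b s := by simpa using (hasDerivAt_id s).mul_const b
  exact (h1.comp s h2).const_mul _

theorem integral_gaussian_over_quadratic (a b : ℝ) (ha : 0 < a) (hb : 0 < b) :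
    ∫ x in Set.Ioi (0 : ℝ), Real.exp (-a ^ 2 * x ^ 2) / (x ^ 2 + b ^ 2)
      = Real.pi / (2 * b) * Real.exp (a ^ 2 * b ^ 2) * (1 - erf (a * b)) := by
  set G : ℝ → ℝ := fun s => ∫ x in Set.Ioi (0 : ℝ),
      Real.exp (-(s ^ 2 * (x ^ 2 + b ^ 2))) / (x ^ 2 + b ^ 2) with hG
  have hcE : Continuous (fun s : ℝ => erf (s * b)) :=
    continuous_iff_continuousAt.2 fun s => (aux_erf b s).continuousAt
  have hcont : Continuous (fun s => G s + Real.pi / (2 * b) * erf (s * b)) :=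
    (aux_cont b hb).add (hcE.const_mul _)
  obtain ⟨c, hc, h⟩ := exists_hasDerivAt_eq_slope
    (fun s => G s + Real.pi / (2 * b) * erf (s * b)) (fun _ => 0) ha hcont.continuousOn (by
      intro s hs
      refine ((aux_deriv b hb s hs.1).add ((aux_erf b s).const_mul _)).congr_deriv ?_
      have h0 : Real.sqrt Real.pi ≠ 0 := by positivity
      have h1 : Real.pi = Real.sqrt Real.pi * Real.sqrt Real.pi :=
        (Real.mul_self_sqrt Real.pi_pos.le).symm
      have h2 : Real.pi / (2 * b) * (2 / Real.sqrt Real.pi * (Real.exp (-(s * b) ^ 2) * b))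
          = Real.sqrt Real.pi * Real.exp (-(s * b) ^ 2) := by
        generalize Real.sqrt Real.pi = r at *
        rw [h1]
        field_simp
      rw [h2]
      ring)
  have hG0 : G 0 = Real.pi / (2 * b) := by
    rw [← (aux_inv b hb).2, hG]
    simp
  have he0 : erf (0 * b) = 0 := by simp [erf]
  have hGa : G a = Real.pi / (2 * b) * (1 - erf (a * b)) := by
    rw [eq_div_iff (by linarith)] at h
    rw [hG0, he0] at h
    linarith
  have hrel : ∀ x : ℝ, Real.exp (-a ^ 2 * x ^ 2) / (x ^ 2 + b ^ 2)
      = Real.exp (a ^ 2 * b ^ 2) * (Real.exp (-(a ^ 2 * (x ^ 2 + b ^ 2))) / (x ^ 2 + b ^ 2)) := by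
    intro x
    rw [← mul_div_assoc, ← Real.exp_add]
    congr 2
    ring
  simp only [hrel]
  rw [MeasureTheory.integral_const_mul]
  change _ * G a = _
  rw [hGa]
  ring
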